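/- Let θ > 0 and for integers n, m ≥ 0 define I_{n,m} := ∫₀^∞ u^n (u+1)^m e^{−2θu} du. Then for every integer n ≥ 1, I_{n−1,n+1} = ((n+θ)/n) · I_{n,n} + (1/2) · I_{n−1,n−1}. -/

import Mathlib

open MeasureTheory

theorem isBigO_pow_mul_add_one_pow_mul_exp {θ : ℝ} (hθ : 0 < θ) (n m : ℕ) :
    (fun u : ℝ => u ^ n * (u + 1) ^ m * Real.exp (-2 * θ * u))
      =O[Filter.atTop] fun u => Real.exp (-θ * u) := by
  have hshift : (fun u : ℝ => u + 1) =O[Filter.atTop] fun u => u :=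
    (Asymptotics.isBigO_refl _ _).add
      (Asymptotics.isLittleO_const_id_atTop (1 : ℝ)).isBigO
  have hpow : (fun u : ℝ => u ^ n * (u + 1) ^ m) =O[Filter.atTop] fun u => Real.exp (θ * u) := by
    refine ((Asymptotics.isBigO_refl (fun u : ℝ => u ^ n) _).mul (hshift.pow m)).trans ?_
    simpa only [pow_add] using (isLittleO_pow_exp_pos_mul_atTop (n + m) hθ).isBigO
  refine (hpow.mul (Asymptotics.isBigO_refl (fun u => Real.exp (-2 * θ * u)) _)).congr_right ?_
  intro u
  rw [← Real.exp_add]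
  ring_nf

theorem integrableOn_pow_mul_add_one_pow_mul_exp {θ : ℝ} (hθ : 0 < θ) (n m : ℕ) :
    IntegrableOn (fun u : ℝ => u ^ n * (u + 1) ^ m * Real.exp (-2 * θ * u)) (Set.Ioi 0) :=
  integrable_of_isBigO_exp_neg hθ (by fun_prop) (isBigO_pow_mul_add_one_pow_mul_exp hθ n m)

theorem tendsto_pow_mul_add_one_pow_mul_exp {θ : ℝ} (hθ : 0 < θ) (n m : ℕ) :
    Filter.Tendsto (fun u : ℝ => u ^ n * (u + 1) ^ m * Real.exp (-2 * θ * u))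
      Filter.atTop (nhds 0) := by
  refine (isBigO_pow_mul_add_one_pow_mul_exp hθ n m).trans_tendsto ?_
  simpa using tendsto_rpow_mul_exp_neg_mul_atTop_nhds_zero 0 θ hθ

/-- Let `θ > 0` and `I_{n,m} = ∫₀^∞ u^n (u+1)^m e^{−2θu} du`.  Then for
every integer `n ≥ 1`, `I_{n−1,n+1} = ((n+θ)/n) I_{n,n} + (1/2) I_{n−1,n−1}`. -/
theorem exponential_integral_recursion
    (θ : ℝ) (hθ : 0 < θ)
    (I : ℕ → ℕ → ℝ)
    (hI : ∀ n m : ℕ, I n m =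
      ∫ u in Set.Ioi (0 : ℝ), u ^ n * (u + 1) ^ m * Real.exp (-2 * θ * u)) :
    ∀ n : ℕ, 1 ≤ n →
      I (n - 1) (n + 1) = (((n : ℝ) + θ) / n) * I n n + (1 / 2) * I (n - 1) (n - 1) := by
  intro n hn
  obtain ⟨k, rfl⟩ : ∃ k, n = k + 1 := ⟨n - 1, by omega⟩
  have hderiv : ∀ u ∈ Set.Ici (0 : ℝ), HasDerivAt
      (fun u : ℝ => u ^ (k + 1) * (u + 1) ^ (k + 1) * Real.exp (-2 * θ * u))
      (2 * (k + 1) * (u ^ k * (u + 1) ^ (k + 2) * Real.exp (-2 * θ * u))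
        - 2 * (k + 1 + θ) * (u ^ (k + 1) * (u + 1) ^ (k + 1) * Real.exp (-2 * θ * u))
        - (k + 1) * (u ^ k * (u + 1) ^ k * Real.exp (-2 * θ * u))) u := by
    intro u _
    have h := ((hasDerivAt_pow (k + 1) u).mul (((hasDerivAt_id u).add_const 1).pow (k + 1))).mul
      ((hasDerivAt_id u).const_mul (-2 * θ)).exp
    refine h.congr_deriv ?_
    simp only [Pi.mul_apply, Pi.pow_apply, id, Nat.add_sub_cancel]
    push_cast
    ring
  have h₁ := (integrableOn_pow_mul_add_one_pow_mul_exp hθ k (k + 2)).const_mul (2 * (k + 1 : ℝ))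
  have h₂ := (integrableOn_pow_mul_add_one_pow_mul_exp hθ (k + 1) (k + 1)).const_mul
    (2 * (k + 1 + θ))
  have h₃ := (integrableOn_pow_mul_add_one_pow_mul_exp hθ k k).const_mul (k + 1 : ℝ)
  have key := integral_Ioi_of_hasDerivAt_of_tendsto' hderiv ((h₁.sub h₂).sub h₃)
    (tendsto_pow_mul_add_one_pow_mul_exp hθ (k + 1) (k + 1))
  rw [integral_sub (by exact h₁.sub h₂) h₃, integral_sub h₁ h₂, integral_const_mul, integral_const_mul,
    integral_const_mul, ← hI, ← hI, ← hI, zero_pow k.succ_ne_zero, zero_mul, zero_mul,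
    sub_zero] at key
  have hk : (k + 1 : ℝ) ≠ 0 := by positivity
  simp only [Nat.add_sub_cancel]
  push_cast
  field_simp
  linear_combination key
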